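/- If t₀ ∈ (0,1) satisfies Y(t₀) = 1 and ρ := r(t₀), then 0.03672841251 < ρ < 0.03672841266. -/

import Mathlib

noncomputable def h1 (t : ℝ) : ℝ := (2*t+1)/((3*t+1)*(1-t))

noncomputable def h2 (t : ℝ) : ℝ :=
  -(t^2*(1-t)*(5*t^2+36*t+18))/(2*(t+3)*(2*t+1)*(3*t+1)^2)

noncomputable def Y (t : ℝ) : ℝ := -1 + h1 t * Real.exp (h2 t)

noncomputable def A (t : ℝ) : ℝ :=
  (3*t-1)*(t+1)^3*Real.log (t+1)/(16*t^3)
  + (3*t+1)*(1-t)^3*Real.log (2*t+1)/(32*t^3)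
  + (1-t)*(185*t^4+698*t^3-217*t^2-160*t+6)/(64*t*(3*t+1)^2*(t+3))

noncomputable def r (t : ℝ) : ℝ :=
  (1/16) * Real.sqrt (3*t+1) * (t⁻¹-1)^3 * Real.exp (A t)

lemma hd1 (t : ℝ) (h0 : 0 < t) (h1' : t < 1) :
    HasDerivAt h1 (6*t*(t+1)/((3*t+1)^2*(1-t)^2)) t := by
  have hx := hasDerivAt_id' t
  have hn : HasDerivAt (fun t : ℝ => 2*t+1) (2*1) t := (hx.const_mul 2).add_const 1
  have h3 : HasDerivAt (fun t : ℝ => 3*t+1) (3*1) t := (hx.const_mul 3).add_const 1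
  have h4 : HasDerivAt (fun t : ℝ => 1-t) (-1) t := hx.const_sub 1
  have e1 : (3*t+1) ≠ 0 := by positivity
  have e2 : (1-t) ≠ 0 := by linarith
  have := hn.div (h3.mul h4) (mul_ne_zero e1 e2)
  refine this.congr_deriv ?_
  simp only [Pi.mul_apply]
  field_simp
  ring

lemma hd2 (t : ℝ) (h0 : 0 < t) :
    HasDerivAt h2 (-(108*t+288*t^2-336*t^3-1464*t^4-1158*t^5-240*t^6-30*t^7)
      /(2*((t+3)*(2*t+1))^2*(3*t+1)^3)) t := by
  have hx := hasDerivAt_id' t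
  have hn : HasDerivAt (fun t : ℝ => 2*t+1) (2*1) t := (hx.const_mul 2).add_const 1
  have h3 : HasDerivAt (fun t : ℝ => 3*t+1) (3*1) t := (hx.const_mul 3).add_const 1
  have h4 : HasDerivAt (fun t : ℝ => 1-t) (-1) t := hx.const_sub 1
  have h5 : HasDerivAt (fun t : ℝ => t+3) 1 t := hx.add_const 3
  have h6 := (((hx.pow 2).const_mul 5).add (hx.const_mul 36)).add_const 18
  have e1 : (3*t+1) ≠ 0 := by positivity
  have e2 : (2*t+1) ≠ 0 := by positivity
  have e3 : (t+3) ≠ 0 := by positivity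
  have := ((((hx.pow 2).mul h4).mul h6).neg).div (((h5.const_mul 2).mul hn).mul (h3.pow 2))
    (mul_ne_zero (mul_ne_zero (mul_ne_zero two_ne_zero e3) e2) (pow_ne_zero 2 e1))
  refine this.congr_deriv ?_
  simp only [Pi.mul_apply, Pi.add_apply, Pi.pow_apply, Pi.neg_apply]
  field_simp
  ring

lemma Y_mono : StrictMonoOn Y (Set.Ioo (0:ℝ) 1) := by
  have key : ∀ t ∈ Set.Ioo (0:ℝ) 1, ∃ d, 0 < d ∧ HasDerivAt Y d t := by
    rintro t ⟨h0, h1'⟩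
    have := ((hd1 t h0 h1').mul (hd2 t h0).exp).const_add (-1)
    refine ⟨_, ?_, this⟩
    have e : 0 < 1 - t := by linarith
    have hP : 0 < 864*t^2+4416*t^3+7536*t^4+4794*t^5+846*t^6+6*t^7-30*t^8 := by
      have : t^8 ≤ t^2 := pow_le_pow_of_le_one h0.le h1'.le (by norm_num)
      have : 0 < t^2 := by positivity
      have : 0 < 4416*t^3+7536*t^4+4794*t^5+846*t^6+6*t^7 := by positivity
      linarith
    have : 6*t*(t+1)/((3*t+1)^2*(1-t)^2) * Real.exp (h2 t) + h1 t * (Real.exp (h2 t) *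
        (-(108*t+288*t^2-336*t^3-1464*t^4-1158*t^5-240*t^6-30*t^7)
      /(2*((t+3)*(2*t+1))^2*(3*t+1)^3))) = Real.exp (h2 t) *
       ((864*t^2+4416*t^3+7536*t^4+4794*t^5+846*t^6+6*t^7-30*t^8)/
        (2*(t+3)^2*(2*t+1)*(3*t+1)^4*(1-t)^2)) := by
      unfold h1
      field_simp
      ring
    rw [this]
    positivity
  apply strictMonoOn_of_deriv_pos (convex_Ioo 0 1)
  · intro t ht
    obtain ⟨d, _, hd⟩ := key t ht
    exact hd.continuousAt.continuousWithinAt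
  · intro t ht
    rw [interior_Ioo] at ht
    obtain ⟨d, h, hd⟩ := key t ht
    rwa [hd.deriv]

lemma Ya : Y 0.62637166330 < 1 := by
  have hq : h2 0.62637166330 ≤ -0.0460123253068 := by unfold h2; norm_num
  have he := Real.sum_le_exp_of_nonneg (x := 0.0460123253068) (by norm_num) 9
  have hv : (1.04708731654 : ℝ) ≤ Real.exp 0.0460123253068 := by
    refine le_trans ?_ he
    norm_num [Finset.sum_range_succ, Nat.factorial]
  have h := Real.exp_le_exp.2 hq
  rw [Real.exp_neg] at h
  have h' : Real.exp (h2 0.62637166330) ≤ (1.04708731654 : ℝ)⁻¹ :=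
    h.trans (inv_anti₀ (by norm_num) hv)
  have hp : 0 < h1 0.62637166330 := by unfold h1; norm_num
  have : h1 0.62637166330 * (1.04708731654 : ℝ)⁻¹ < 2 := by unfold h1; norm_num
  unfold Y
  have := mul_le_mul_of_nonneg_left h' hp.le
  linarith

lemma Yb : 1 < Y 0.62637166331 := by
  have hq : -0.04601232530601 ≤ h2 0.62637166331 := by unfold h2; norm_num
  have he := Real.exp_bound' (x := 0.04601232530601) (by norm_num) (by norm_num) (n := 9) (by norm_num)
  have hv : Real.exp 0.04601232530601 ≤ (1.04708731655 : ℝ) := by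
    refine le_trans he ?_
    norm_num [Finset.sum_range_succ, Nat.factorial]
  have h := Real.exp_le_exp.2 hq
  rw [Real.exp_neg] at h
  have h' : (1.04708731655 : ℝ)⁻¹ ≤ Real.exp (h2 0.62637166331) :=
    (inv_anti₀ (Real.exp_pos _) hv).trans h
  have hp : 0 < h1 0.62637166331 := by unfold h1; norm_num
  have : 2 < h1 0.62637166331 * (1.04708731655 : ℝ)⁻¹ := by unfold h1; norm_num
  unfold Y
  have := mul_le_mul_of_nonneg_left h' hp.le
  linarith

lemma A_bounds (a b t l1 u1 l2 u2 : ℝ) (ha : 1/3 < a) (hb : b < 1) (hat : a ≤ t) (htb : t ≤ b)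
    (hl1 : l1 ≤ Real.log (t+1)) (hu1 : Real.log (t+1) ≤ u1)
    (hl2 : l2 ≤ Real.log (2*t+1)) (hu2 : Real.log (2*t+1) ≤ u2) (p1 : 0 < l1) (p2 : 0 < l2)
    (hp : 0 ≤ 185*a^4+698*a^3-217*b^2-160*b+6) :
    (3*a-1)*(a+1)^3*l1/(16*b^3) + (3*a+1)*(1-b)^3*l2/(32*b^3)
      + (1-b)*(185*a^4+698*a^3-217*b^2-160*b+6)/(64*b*(3*b+1)^2*(b+3)) ≤ A t ∧
    A t ≤ (3*b-1)*(b+1)^3*u1/(16*a^3) + (3*b+1)*(1-a)^3*u2/(32*a^3)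
      + (1-a)*(185*b^4+698*b^3-217*a^2-160*a+6)/(64*a*(3*a+1)^2*(a+3)) := by
  have a0 : 0 < a := by linarith
  have t0 : 0 < t := by linarith
  have b0 : 0 < b := by linarith
  have q1 : 0 < 3*a-1 := by linarith
  have q2 : 0 < 3*t-1 := by linarith
  have q2' : 0 < 3*b-1 := by linarith
  have q3 : 0 < 1-t := by linarith
  have q4 : 0 < 1-b := by linarith
  have q4' : 0 < 1-a := by linarith
  have r1 : 185*a^4+698*a^3-217*b^2-160*b+6 ≤ 185*t^4+698*t^3-217*t^2-160*t+6 := by gcongr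
  have r2 : 185*t^4+698*t^3-217*t^2-160*t+6 ≤ 185*b^4+698*b^3-217*a^2-160*a+6 := by gcongr
  have r0 := hp.trans r1
  have r0' := r0.trans r2
  have g1 : 0 < Real.log (t+1) := by linarith
  have g2 : 0 < Real.log (2*t+1) := by linarith
  have g3 : 0 < u1 := by linarith
  have g4 : 0 < u2 := by linarith
  unfold A
  generalize 185*a^4+698*a^3-217*b^2-160*b+6 = x at *
  generalize 185*t^4+698*t^3-217*t^2-160*t+6 = y at *
  generalize 185*b^4+698*b^3-217*a^2-160*a+6 = z at *
  constructor
  · gcongr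
  · gcongr

lemma log_b1 : (0.486351560221 : ℝ) ≤ Real.log 1.62637166330 := by
  rw [Real.le_log_iff_exp_le (by norm_num)]
  refine (Real.exp_bound' (by norm_num) (by norm_num) (n := 14) (by norm_num)).trans ?_
  norm_num [Finset.sum_range_succ, Nat.factorial]

lemma log_b2 : Real.log 1.62637166331 ≤ (0.486351560228 : ℝ) := by
  rw [Real.log_le_iff_le_exp (by norm_num)]
  refine le_trans ?_ (Real.sum_le_exp_of_nonneg (by norm_num) 14)
  norm_num [Finset.sum_range_succ, Nat.factorial]

lemma log_b3 : (0.812148729793 : ℝ) ≤ Real.log 2.25274332660 := by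
  rw [Real.le_log_iff_exp_le (by norm_num)]
  refine (Real.exp_bound' (by norm_num) (by norm_num) (n := 16) (by norm_num)).trans ?_
  norm_num [Finset.sum_range_succ, Nat.factorial]

lemma log_b4 : Real.log 2.25274332662 ≤ (0.812148729803 : ℝ) := by
  rw [Real.log_le_iff_le_exp (by norm_num)]
  refine le_trans ?_ (Real.sum_le_exp_of_nonneg (by norm_num) 16)
  norm_num [Finset.sum_range_succ, Nat.factorial]

theorem rho_bounds : ∀ t₀ : ℝ, t₀ ∈ Set.Ioo (0:ℝ) 1 → Y t₀ = 1 →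
    ∀ ρ : ℝ, ρ = r t₀ →
    0.03672841251 < ρ ∧ ρ < 0.03672841266 := by
  intro t ht hY ρ hρ
  subst hρ
  have hat : 0.62637166330 < t := by
    by_contra h
    have := Y_mono.monotoneOn ht (by constructor <;> norm_num) (not_lt.1 h)
    have := Ya
    linarith
  have htb : t < 0.62637166331 := by
    by_contra h
    have := Y_mono.monotoneOn (by constructor <;> norm_num) ht (not_lt.1 h)
    have := Yb
    linarith
  have t0 := ht.1
  obtain ⟨hA1, hA2⟩ := A_bounds 0.62637166330 0.62637166331 t 0.486351560221 0.486351560228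
    0.812148729793 0.812148729803 (by norm_num) (by norm_num) hat.le htb.le
    (log_b1.trans (Real.log_le_log (by norm_num) (by linarith)))
    ((Real.log_le_log (by linarith) (by linarith)).trans log_b2)
    (log_b3.trans (Real.log_le_log (by norm_num) (by linarith)))
    ((Real.log_le_log (by linarith) (by linarith)).trans log_b4)
    (by norm_num) (by norm_num) (by norm_num)
  have hA1 : 0.48968967302 ≤ A t := le_trans (by norm_num) hA1
  have hA2 : A t ≤ 0.48968967309 := le_trans hA2 (by norm_num)
  have E1 : (1.63180974677 : ℝ) ≤ Real.exp (A t) := by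
    refine le_trans ?_ ((Real.sum_le_exp_of_nonneg (by norm_num) 14).trans (Real.exp_le_exp.2 hA1))
    norm_num [Finset.sum_range_succ, Nat.factorial]
  have E2 : Real.exp (A t) ≤ (1.63180974691 : ℝ) := by
    refine (Real.exp_le_exp.2 hA2).trans
      ((Real.exp_bound' (by norm_num) (by norm_num) (n := 14) (by norm_num)).trans ?_)
    norm_num [Finset.sum_range_succ, Nat.factorial]
  have S1 : (1.69679550621 : ℝ) ≤ Real.sqrt (3*t+1) := Real.le_sqrt_of_sq_le (by linarith)
  have S2 : Real.sqrt (3*t+1) ≤ (1.69679550623 : ℝ) :=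
    Real.sqrt_le_iff.2 ⟨by norm_num, by linarith⟩
  have I1 : (0.62637166331 : ℝ)⁻¹ - 1 ≤ t⁻¹ - 1 := by gcongr
  have I2 : t⁻¹ - 1 ≤ (0.62637166330 : ℝ)⁻¹ - 1 := by gcongr
  have I0 : (0:ℝ) ≤ (0.62637166331 : ℝ)⁻¹ - 1 := by norm_num
  have I0' : (0:ℝ) ≤ t⁻¹ - 1 := I0.trans I1
  have I0'' : (0:ℝ) ≤ (0.62637166330 : ℝ)⁻¹ - 1 := I0'.trans I2
  unfold r
  constructor
  · calc (0.03672841251 : ℝ) < (1/16) * 1.69679550621 * ((0.62637166331 : ℝ)⁻¹ - 1)^3 * 1.63180974677 := by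
          norm_num
      _ ≤ _ := by gcongr
  · calc _ ≤ (1/16) * 1.69679550623 * ((0.62637166330 : ℝ)⁻¹ - 1)^3 * 1.63180974691 := by gcongr
      _ < _ := by norm_num
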